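/- Assume (∂²B)_v is positive semi-definite for every v ≠ 0, and that either B(v) ≥ 0 for all v ∈ V or B is linear. Then F_B := B/Λ + √(B²/Λ² + F²/Λ) is a Minkowski norm on V: F_B is continuous and nonnegative on V, positively homogeneous of degree 1, F_B(0) = 0 and F_B(v) > 0 for every v ≠ 0, F_B is twice continuously differentiable on V ∖ {0}, and the second derivative of F_B² at every v ≠ 0 is a positive definite bilinear form on V. (This is the fiberwise content of the statement that the Fermat metric F_B is a Finsler metric.) -/

import Mathlib

/-- The Fermat metric `F_B := B/Λ + √(B²/Λ² + F²/Λ)`. -/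
noncomputable def fermatFB {V : Type*} (Λ : ℝ) (B F : V → ℝ) (v : V) : ℝ :=
  B v / Λ + Real.sqrt ((B v) ^ 2 / Λ ^ 2 + (F v) ^ 2 / Λ)

/-- A function with a continuous second derivative on an open set is `C²` there. -/
theorem contDiffOn_two_of_hasFDerivAt {E G : Type*} [NormedAddCommGroup E] [NormedSpace ℝ E]
    [NormedAddCommGroup G] [NormedSpace ℝ G] {s : Set E} (hs : IsOpen s) {f : E → G}
    {f' : E → E →L[ℝ] G} {f'' : E → E →L[ℝ] E →L[ℝ] G}
    (hf : ∀ x ∈ s, HasFDerivAt f (f' x) x) (hf' : ∀ x ∈ s, HasFDerivAt f' (f'' x) x)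
    (hc : ContinuousOn f'' s) : ContDiffOn ℝ 2 f s := by
  have h1 : ContDiffOn ℝ 1 f' s := by
    rw [show (1 : WithTop ℕ∞) = 0 + 1 from rfl, contDiffOn_succ_iff_fderiv_of_isOpen hs]
    refine ⟨fun x hx => (hf' x hx).differentiableAt.differentiableWithinAt, by simp, ?_⟩
    exact contDiffOn_zero.2 (hc.congr fun x hx => (hf' x hx).fderiv)
  rw [show (2 : WithTop ℕ∞) = 1 + 1 from one_add_one_eq_two.symm,
    contDiffOn_succ_iff_fderiv_of_isOpen hs]
  exact ⟨fun x hx => (hf x hx).differentiableAt.differentiableWithinAt, by simp,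
    h1.congr fun x hx => (hf x hx).fderiv⟩

/-- Euler's relation for a function that is positively homogeneous of degree `n`. -/
theorem HasFDerivAt.apply_self_of_homogeneous {E G : Type*} [NormedAddCommGroup E]
    [NormedSpace ℝ E] [NormedAddCommGroup G] [NormedSpace ℝ G] {f : E → G} {f' : E →L[ℝ] G}
    {v : E} (n : ℕ) (hf : HasFDerivAt f f' v)
    (hom : ∀ l : ℝ, 0 < l → f (l • v) = l ^ n • f v) : f' v = (n : ℝ) • f v := by
  have h1 : HasDerivAt (fun l : ℝ => f (l • v)) (f' v) 1 := by
    have hl : HasDerivAt (fun l : ℝ => l • v) v 1 := by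
      simpa using (hasDerivAt_id (1 : ℝ)).smul_const v
    have hf1 : HasFDerivAt f f' ((1 : ℝ) • v) := by simpa using hf
    exact hf1.comp_hasDerivAt 1 hl
  have h2 : HasDerivAt (fun l : ℝ => l ^ n • f v) ((n : ℝ) • f v) 1 := by
    simpa using (hasDerivAt_pow n (1 : ℝ)).smul_const (f v)
  refine h1.unique (h2.congr_of_eventuallyEq ?_)
  filter_upwards [lt_mem_nhds (zero_lt_one : (0 : ℝ) < 1)] with l hl using hom l hl

/-- The derivative of a positively 2-homogeneous function is positively 1-homogeneous. -/
theorem HasFDerivAt.smul_of_homogeneous_two {E G : Type*} [NormedAddCommGroup E]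
    [NormedSpace ℝ E] [NormedAddCommGroup G] [NormedSpace ℝ G] {f : E → G} {f₁ f₂ : E →L[ℝ] G}
    {v : E} {l : ℝ} (hl : 0 < l) (hf₁ : HasFDerivAt f f₁ v) (hf₂ : HasFDerivAt f f₂ (l • v))
    (hom : ∀ w, f (l • w) = l ^ 2 • f w) : f₂ = l • f₁ := by
  have h1 : HasFDerivAt (fun w => f (l • w)) (f₂.comp (l • ContinuousLinearMap.id ℝ E)) v :=
    hf₂.comp v ((hasFDerivAt_id v).const_smul l)
  have h2 : HasFDerivAt (fun w => f (l • w)) (l ^ 2 • f₁) v := by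
    simp only [hom]
    exact hf₁.const_smul (l ^ 2)
  have h3 := h1.unique h2
  ext u
  have h4 := DFunLike.congr_fun h3 u
  simp only [ContinuousLinearMap.comp_apply, smul_apply,
    ContinuousLinearMap.id_apply, map_smul, pow_two, mul_smul] at h4
  exact smul_right_injective G hl.ne' h4

/-- A positively homogeneous function of degree one vanishes at the origin. -/
theorem map_zero_of_pos_homogeneous {E : Type*} [AddCommGroup E] [Module ℝ E] {f : E → ℝ}
    (hom : ∀ l : ℝ, 0 < l → ∀ v, f (l • v) = l * f v) : f 0 = 0 := by
  have h := hom 2 two_pos 0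
  rw [smul_zero] at h
  linarith

/-- The quadratic equation whose nonnegative root is the Fermat metric. -/
theorem fermatFB_quadratic {V : Type*} {Λ : ℝ} (hΛ : 0 < Λ) (B F : V → ℝ) (v : V) :
    Λ * fermatFB Λ B F v ^ 2 = 2 * B v * fermatFB Λ B F v + F v ^ 2 := by
  have h : 0 ≤ B v ^ 2 / Λ ^ 2 + F v ^ 2 / Λ := by positivity
  have hs := Real.sq_sqrt h
  unfold fermatFB
  generalize Real.sqrt (B v ^ 2 / Λ ^ 2 + F v ^ 2 / Λ) = r at hs
  field_simp at hs ⊢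
  linear_combination hs

theorem fermatFB_nonneg {V : Type*} (Λ : ℝ) (hΛ : 0 < Λ) (B F : V → ℝ) (v : V) :
    0 ≤ fermatFB Λ B F v := by
  have h : |B v / Λ| ≤ Real.sqrt (B v ^ 2 / Λ ^ 2 + F v ^ 2 / Λ) := by
    apply Real.abs_le_sqrt
    rw [div_pow]
    linarith [show 0 ≤ F v ^ 2 / Λ by positivity]
  have := neg_le_of_abs_le h
  unfold fermatFB
  linarith

theorem fermatFB_pos {V : Type*} {Λ : ℝ} (hΛ : 0 < Λ) (B F : V → ℝ) {v : V} (hF : 0 < F v) :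
    0 < fermatFB Λ B F v := by
  refine (fermatFB_nonneg Λ hΛ B F v).lt_of_ne fun h => ?_
  have hq := fermatFB_quadratic hΛ B F v
  rw [← h] at hq
  nlinarith [pow_pos hF 2]

theorem fermatFB_sub_pos {V : Type*} {Λ : ℝ} (hΛ : 0 < Λ) (B F : V → ℝ) {v : V}
    (hF : 0 < F v) : 0 < Λ * fermatFB Λ B F v - B v := by
  have h : 0 < Real.sqrt (B v ^ 2 / Λ ^ 2 + F v ^ 2 / Λ) := Real.sqrt_pos.2 (by positivity)
  have : Λ * fermatFB Λ B F v - B v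
      = Λ * Real.sqrt (B v ^ 2 / Λ ^ 2 + F v ^ 2 / Λ) := by
    unfold fermatFB
    field_simp
    ring
  rw [this]
  positivity

theorem fermatFB_smul {V : Type*} [AddCommGroup V] [Module ℝ V] (Λ : ℝ) {B F : V → ℝ} {l : ℝ}
    (hl : 0 < l) {v : V} (hB : B (l • v) = l * B v) (hF : F (l • v) = l * F v) :
    fermatFB Λ B F (l • v) = l * fermatFB Λ B F v := by
  unfold fermatFB
  rw [hB, hF, show (l * B v) ^ 2 / Λ ^ 2 + (l * F v) ^ 2 / Λ
    = l ^ 2 * (B v ^ 2 / Λ ^ 2 + F v ^ 2 / Λ) by ring, Real.sqrt_mul (sq_nonneg l),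
    Real.sqrt_sq hl.le]
  ring

theorem contDiffOn_fermatFB {V : Type*} [NormedAddCommGroup V] [NormedSpace ℝ V] {Λ : ℝ}
    (hΛ : 0 < Λ) {B F : V → ℝ} {s : Set V} {n : WithTop ℕ∞} (hB : ContDiffOn ℝ n B s)
    (hF : ContDiffOn ℝ n (fun w => F w ^ 2) s) (hpos : ∀ v ∈ s, 0 < F v) :
    ContDiffOn ℝ n (fermatFB Λ B F) s := by
  have hr : ContDiffOn ℝ n (fun v => B v ^ 2 / Λ ^ 2 + F v ^ 2 / Λ) s :=
    ((hB.pow 2).div_const _).add (hF.div_const _)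
  refine (hB.div_const Λ).add (hr.sqrt fun v hv => ne_of_gt ?_)
  have := hpos v hv
  positivity

/-- The first-order relation obtained by differentiating `fermatFB_quadratic`. -/
theorem fermatFB_fderiv_relation {V : Type*} [NormedAddCommGroup V] [NormedSpace ℝ V] {Λ : ℝ}
    (hΛ : 0 < Λ) {B F : V → ℝ} {v : V} {b q p : V →L[ℝ] ℝ} (hB : HasFDerivAt B b v)
    (hF : HasFDerivAt (fun w => F w ^ 2) q v) (hp : HasFDerivAt (fermatFB Λ B F) p v) (u : V) :
    (Λ * fermatFB Λ B F v - B v) * p u = fermatFB Λ B F v * b u + q u / 2 := by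
  have h1 := (hp.pow 2).const_mul Λ
  have h2 := ((hB.const_mul 2).mul hp).add hF
  have h3 := h1.unique (h2.congr_of_eventuallyEq
    (.of_forall fun w => fermatFB_quadratic hΛ B F w))
  have h4 := DFunLike.congr_fun h3 u
  simp at h4
  linarith

/-- The second-order relation obtained by differentiating `fermatFB_quadratic` twice. -/
theorem fermatFB_snd_fderiv_relation {V : Type*} [NormedAddCommGroup V] [NormedSpace ℝ V]
    {Λ : ℝ} (hΛ : 0 < Λ) {B F : V → ℝ} {b q p : V → V →L[ℝ] ℝ} {v : V}
    {b₂ g p₂ : V →L[ℝ] V →L[ℝ] ℝ}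
    (hB : ∀ᶠ w in nhds v, HasFDerivAt B (b w) w)
    (hF : ∀ᶠ w in nhds v, HasFDerivAt (fun w => F w ^ 2) (q w) w)
    (hp : ∀ᶠ w in nhds v, HasFDerivAt (fermatFB Λ B F) (p w) w)
    (hb : HasFDerivAt b b₂ v) (hq : HasFDerivAt q ((2 : ℝ) • g) v) (hp₂ : HasFDerivAt p p₂ v)
    (u : V) :
    (Λ * p v u - b v u) * p v u + (Λ * fermatFB Λ B F v - B v) * p₂ u u
      = p v u * b v u + fermatFB Λ B F v * b₂ u u + g u u := by
  have ev : ∀ {f : V → V →L[ℝ] ℝ} {f' : V →L[ℝ] V →L[ℝ] ℝ}, HasFDerivAt f f' v →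
      HasFDerivAt (fun w => f w u) (f'.flip u) v := fun h => by
    simpa using h.clm_apply (hasFDerivAt_const u v)
  have h1 := ((hp.self_of_nhds.const_mul Λ).sub hB.self_of_nhds).mul (ev hp₂)
  have h2 := (hp.self_of_nhds.mul (ev hb)).add ((ev hq).mul_const (1 / 2 : ℝ))
  have h3 := h1.unique (h2.congr_of_eventuallyEq (by
    filter_upwards [hB, hF, hp] with w hBw hFw hpw
    have := fermatFB_fderiv_relation hΛ hBw hFw hpw u
    simpa [div_eq_mul_inv] using this))
  have h4 := DFunLike.congr_fun h3 u
  simp at h4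
  linarith

/-- Positivity of `p² + φ φ''`, half the Hessian of `φ²`, in a direction `u` and for
`R = Λ φ - B`; here `c`, `d`, `e` stand for `g_v(v,u)`, `g_v(u,u)`, `g_v(v,v)`. -/
theorem fermat_hessian_pos {Λ φ B R p b b₂ p₂ c d e : ℝ} (hφ : 0 < φ) (hR : 0 < R)
    (hRdef : R = Λ * φ - B) (hquad : Λ * φ ^ 2 = 2 * B * φ + e)
    (h1 : R * p = φ * b + c) (h2 : (Λ * p - b) * p + R * p₂ = p * b + φ * b₂ + d)
    (hb₂ : 0 ≤ b₂) (hg : 0 ≤ d - 2 * (p / φ) * c + (p / φ) ^ 2 * e) (hd : 0 < d) :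
    0 < p ^ 2 + φ * p₂ := by
  have key : R * (p ^ 2 + φ * p₂) = R * p ^ 2 + φ ^ 2 * b₂
      + φ * (d - 2 * (p / φ) * c + (p / φ) ^ 2 * e) := by
    have he : e = φ * (2 * R - Λ * φ) := by rw [hRdef]; linarith
    rw [he]
    field_simp
    linear_combination φ * h2 - 2 * p * h1
  refine pos_of_mul_pos_right ?_ hR.le
  rw [key]
  rcases eq_or_ne p 0 with rfl | hp
  · simp only [zero_div]
    have := mul_pos hφ hd
    have := mul_nonneg (sq_nonneg φ) hb₂
    nlinarith
  · positivity

/-- if `(∂²B)_v` is positive semi-definite for every `v ≠ 0` and either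
`B ≥ 0` or `B` is linear, then `F_B = B/Λ + √(B²/Λ² + F²/Λ)` is a Minkowski norm. -/
theorem fermat_FB_is_minkowski_norm
    {V : Type*} [NormedAddCommGroup V] [NormedSpace ℝ V] [FiniteDimensional ℝ V]
    (Λ : ℝ) (hΛ : 0 < Λ)
    (B : V → ℝ) (B' : V → V →L[ℝ] ℝ) (B'' : V → V →L[ℝ] V →L[ℝ] ℝ)
    (hBcont : Continuous B)
    (hBhom : ∀ l : ℝ, 0 < l → ∀ v, B (l • v) = l * B v)
    (hB' : ∀ v : V, v ≠ 0 → HasFDerivAt B (B' v) v)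
    (hB'' : ∀ v : V, v ≠ 0 → HasFDerivAt B' (B'' v) v)
    (hB''cont : ContinuousOn B'' {0}ᶜ)
    (hB''symm : ∀ v : V, v ≠ 0 → ∀ u w : V, B'' v u w = B'' v w u)
    (F : V → ℝ) (F2' : V → V →L[ℝ] ℝ) (g : V → V →L[ℝ] V →L[ℝ] ℝ)
    (hFcont : Continuous F) (hFnonneg : ∀ v, 0 ≤ F v)
    (hFhom : ∀ l : ℝ, 0 < l → ∀ v, F (l • v) = l * F v)
    (hFpos : ∀ v : V, v ≠ 0 → 0 < F v)
    (hF2' : ∀ v : V, v ≠ 0 → HasFDerivAt (fun w => (F w) ^ 2) (F2' v) v)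
    (hg : ∀ v : V, v ≠ 0 → HasFDerivAt F2' ((2 : ℝ) • g v) v)
    (hgcont : ContinuousOn g {0}ᶜ)
    (hgsymm : ∀ v : V, v ≠ 0 → ∀ u w : V, g v u w = g v w u)
    (hgpos : ∀ v : V, v ≠ 0 → ∀ u : V, u ≠ 0 → 0 < g v u u)
    (hpsd : ∀ v : V, v ≠ 0 → ∀ u : V, 0 ≤ B'' v u u)
    (halt : (∀ v : V, 0 ≤ B v) ∨ IsLinearMap ℝ B) :
    Continuous (fermatFB Λ B F) ∧
    (∀ v : V, 0 ≤ fermatFB Λ B F v) ∧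
    (∀ l : ℝ, 0 < l → ∀ v : V, fermatFB Λ B F (l • v) = l * fermatFB Λ B F v) ∧
    fermatFB Λ B F 0 = 0 ∧
    (∀ v : V, v ≠ 0 → 0 < fermatFB Λ B F v) ∧
    ContDiffOn ℝ 2 (fermatFB Λ B F) {0}ᶜ ∧
    ∃ (FB2' : V → V →L[ℝ] ℝ) (FB2'' : V → V →L[ℝ] V →L[ℝ] ℝ),
      (∀ v : V, v ≠ 0 → HasFDerivAt (fun w => (fermatFB Λ B F w) ^ 2) (FB2' v) v) ∧
      (∀ v : V, v ≠ 0 → HasFDerivAt FB2' (FB2'' v) v) ∧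
      (∀ v : V, v ≠ 0 → ∀ u : V, u ≠ 0 → 0 < FB2'' v u u) := by
  have hopen : IsOpen ({0}ᶜ : Set V) := isOpen_compl_singleton
  have hnz : ∀ v : V, v ≠ 0 → ∀ᶠ w in nhds v, w ≠ 0 := fun v hv => hopen.mem_nhds hv
  have hsmooth : ContDiffOn ℝ 2 (fermatFB Λ B F) {0}ᶜ :=
    contDiffOn_fermatFB hΛ (contDiffOn_two_of_hasFDerivAt hopen hB' hB'' hB''cont)
      (contDiffOn_two_of_hasFDerivAt hopen hF2' hg (hgcont.const_smul (2 : ℝ))) hFpos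
  have hφ' : ∀ v : V, v ≠ 0 →
      HasFDerivAt (fermatFB Λ B F) (fderiv ℝ (fermatFB Λ B F) v) v := fun v hv =>
    ((hsmooth.contDiffAt (hopen.mem_nhds hv)).differentiableAt (by simp)).hasFDerivAt
  have hφ'' : ∀ v : V, v ≠ 0 → HasFDerivAt (fderiv ℝ (fermatFB Λ B F))
      (fderiv ℝ (fderiv ℝ (fermatFB Λ B F)) v) v := fun v hv =>
    (((hsmooth.contDiffAt (hopen.mem_nhds hv)).fderiv_right (m := 1)
      (by norm_num [one_add_one_eq_two])).differentiableAt (by simp)).hasFDerivAt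
  have hF2hom : ∀ l : ℝ, 0 < l → ∀ w, F (l • w) ^ 2 = l ^ 2 • F w ^ 2 := fun l hl w => by
    rw [hFhom l hl, smul_eq_mul, mul_pow]
  have hgv : ∀ v : V, v ≠ 0 → ∀ u, F2' v u = 2 * g v v u := fun v hv u => by
    have h := (hg v hv).apply_self_of_homogeneous 1 fun l hl => by
      rw [pow_one]
      exact (hF2' v hv).smul_of_homogeneous_two hl (hF2' _ (smul_ne_zero hl.ne' hv))
        (hF2hom l hl)
    simpa using (DFunLike.congr_fun h u).symm
  have hgvv : ∀ v : V, v ≠ 0 → g v v v = F v ^ 2 := fun v hv => by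
    have h := (hF2' v hv).apply_self_of_homogeneous 2 fun l hl => hF2hom l hl v
    rw [hgv v hv] at h
    simpa using h
  refine ⟨?_, fermatFB_nonneg Λ hΛ B F, fun l hl v => fermatFB_smul Λ hl (hBhom l hl v)
    (hFhom l hl v), ?_, fun v hv => fermatFB_pos hΛ B F (hFpos v hv), hsmooth,
    fun v => (2 * fermatFB Λ B F v) • fderiv ℝ (fermatFB Λ B F) v,
    fun v => (2 * fermatFB Λ B F v) • fderiv ℝ (fderiv ℝ (fermatFB Λ B F)) v
      + ((2 : ℝ) • fderiv ℝ (fermatFB Λ B F) v).smulRight (fderiv ℝ (fermatFB Λ B F) v),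
    fun v hv => ?_, fun v hv => ((hφ' v hv).const_mul 2).smul (hφ'' v hv), fun v hv u hu => ?_⟩
  · unfold fermatFB
    fun_prop
  · simp [fermatFB, map_zero_of_pos_homogeneous hBhom, map_zero_of_pos_homogeneous hFhom]
  · simpa using (hφ' v hv).pow 2
  · have hpos := fermat_hessian_pos (fermatFB_pos hΛ B F (hFpos v hv))
      (fermatFB_sub_pos hΛ B F (hFpos v hv)) rfl
      (e := g v v v) (c := g v v u) (d := g v u u) (p := fderiv ℝ (fermatFB Λ B F) v u)
      (by rw [hgvv v hv]; exact fermatFB_quadratic hΛ B F v)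
      (by
        rw [fermatFB_fderiv_relation hΛ (hB' v hv) (hF2' v hv) (hφ' v hv) u, hgv v hv]
        ring)
      (fermatFB_snd_fderiv_relation hΛ ((hnz v hv).mono hB') ((hnz v hv).mono hF2')
        ((hnz v hv).mono hφ') (hB'' v hv) (hg v hv) (hφ'' v hv) u)
      (hpsd v hv u)
      (by
        set t := fderiv ℝ (fermatFB Λ B F) v u / fermatFB Λ B F v
        have h : 0 ≤ g v (u - t • v) (u - t • v) := by
          rcases eq_or_ne (u - t • v) 0 with h0 | h0
          · simp [h0]
          · exact (hgpos v hv _ h0).le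
        simp only [map_sub, map_smul, sub_apply,
          smul_apply, smul_eq_mul, hgsymm v hv u v] at h
        linarith)
      (hgpos v hv u hu)
    simp only [add_apply, smul_apply,
      ContinuousLinearMap.smulRight_apply, smul_eq_mul]
    linarith
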